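/- arXiv:1208.1541 — 4 statements merged into one kernel-verified Lean document; each statement's English description precedes it below -/
import Mathlib

section
/- Let ε > 0, α > 0, let I ⊆ ℝ be an open interval, and let φ : ℝ × I → ℂ be smooth and nowhere vanishing, satisfying the MNLS equation iε∂ₜφ + (ε²/2)∂ₓ²φ + |φ|²φ + iαε∂ₓ(|φ|²φ) = 0. Define ρ := |φ|² and u := ε·Im(∂ₓφ/φ). Then ∂ₜρ + ∂ₓ(ρu + (3/2)αρ²) = 0 and ∂ₜu + ∂ₓ((1/2)u² − ρ + αρu) = (ε²/2)∂ₓF, where F := (1/(2ρ))∂ₓ²ρ − ((1/(2ρ))∂ₓρ)². -/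
open Complex Real Filter Set Topology

noncomputable section

/-- The Madelung density `ρ = |φ|²`. -/
def madRho (φ : ℝ → ℝ → ℂ) (x t : ℝ) : ℝ := ‖φ x t‖^2

/-- The Madelung velocity `u = ε·Im(∂ₓφ/φ)`. -/
def madU (ε : ℝ) (φ : ℝ → ℝ → ℂ) (x t : ℝ) : ℝ :=
  ε * ((deriv (fun y => φ y t) x) / φ x t).im

/-- The dispersive correction `F[ρ] = (1/(2ρ))∂ₓ²ρ − ((1/(2ρ))∂ₓρ)²`. -/
def madF (φ : ℝ → ℝ → ℂ) (x t : ℝ) : ℝ :=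
  (1/(2 * madRho φ x t)) * deriv (fun y => deriv (fun y' => madRho φ y' t) y) x
    - ((1/(2 * madRho φ x t)) * deriv (fun y => madRho φ y t) x)^2

/-- Logarithmic differentiation of `‖p‖²`. -/
lemma hasDerivAt_norm_sq_of_ne_zero {p : ℝ → ℂ} {p' : ℂ} {x : ℝ} (h : HasDerivAt p p' x)
    (h0 : p x ≠ 0) :
    HasDerivAt (fun y => ‖p y‖ ^ 2) (2 * ‖p x‖ ^ 2 * (p' / p x).re) x := by
  convert h.norm_sq using 1
  have hn : Complex.normSq (p x) ≠ 0 := by simpa using h0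
  rw [Complex.inner, ← Complex.normSq_eq_norm_sq, Complex.div_re]
  field_simp
  simp [Complex.mul_re]

lemma hasDerivAt_re {p : ℝ → ℂ} {p' : ℂ} {x : ℝ} (h : HasDerivAt p p' x) :
    HasDerivAt (fun y => (p y).re) p'.re x :=
  Complex.reCLM.hasFDerivAt.comp_hasDerivAt x h

lemma hasDerivAt_im {p : ℝ → ℂ} {p' : ℂ} {x : ℝ} (h : HasDerivAt p p' x) :
    HasDerivAt (fun y => (p y).im) p'.im x :=
  Complex.imCLM.hasFDerivAt.comp_hasDerivAt x h

/-- The Madelung equations on a time slice, with `q` in the role of `∂ₜφ`. -/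
lemma madelung_slice {ε α t : ℝ} (hε : 0 < ε) {φ : ℝ → ℝ → ℂ} {q : ℝ → ℂ}
    (hφ : ContDiff ℝ (⊤ : ℕ∞) (fun y => φ y t)) (h0 : ∀ x, φ x t ≠ 0)
    (hq : ∀ x : ℝ,
      Complex.I * (ε:ℂ) * q x
        + ((ε:ℂ)^2/2) * deriv (fun y => deriv (fun y' => φ y' t) y) x
        + (‖φ x t‖ : ℂ)^2 * φ x t
        + Complex.I * (α:ℂ) * (ε:ℂ) *
            deriv (fun y => (‖φ y t‖ : ℂ)^2 * φ y t) x = 0) (x : ℝ) :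
    (2 * ‖φ x t‖ ^ 2 * (q x / φ x t).re
        + deriv (fun y => madRho φ y t * madU ε φ y t + (3/2)*α*(madRho φ y t)^2) x = 0) ∧
      (ε * deriv (fun y => (q y / φ y t).im) x
        + deriv (fun y => (1/2)*(madU ε φ y t)^2 - madRho φ y t
            + α*(madRho φ y t)*(madU ε φ y t)) x
        = (ε^2/2) * deriv (fun y => madF φ y t) x) := by
  set p : ℝ → ℂ := fun y => φ y t with hp
  have hp' : ContDiff ℝ (⊤ : ℕ∞) (deriv p) := (contDiff_infty_iff_deriv.1 hφ).2
  set L : ℝ → ℂ := fun y => deriv p y / p y with hL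
  have hLs : ContDiff ℝ (⊤ : ℕ∞) L := by
    simp only [hL, div_eq_mul_inv]
    exact hp'.mul (hφ.inv h0)
  have hLs' : ContDiff ℝ (⊤ : ℕ∞) (deriv L) := (contDiff_infty_iff_deriv.1 hLs).2
  have dp (y) : HasDerivAt p (deriv p y) y := (hφ.differentiable (by simp) y).hasDerivAt
  have dL (y) : HasDerivAt L (deriv L y) y := (hLs.differentiable (by simp) y).hasDerivAt
  have dL' (y) : HasDerivAt (deriv L) (deriv (deriv L) y) y :=
    (hLs'.differentiable (by simp) y).hasDerivAt
  have hpL (y) : deriv p y = L y * p y := (div_mul_cancel₀ _ (h0 y)).symm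
  have hpp (y) : deriv (deriv p) y = (deriv L y + L y ^ 2) * p y := by
    rw [show deriv p = fun y => L y * p y from funext hpL, ((dL y).fun_mul (dp y)).deriv, hpL]
    ring
  set ρ : ℝ → ℝ := fun y => ‖p y‖ ^ 2 with hρ
  have ρ0 (y) : ρ y ≠ 0 := by simpa [hρ] using h0 y
  have dρ (y) : HasDerivAt ρ (2 * ρ y * (L y).re) y :=
    hasDerivAt_norm_sq_of_ne_zero (dp y) (h0 y)
  have dρ' (y) : HasDerivAt (fun y => 2 * ρ y * (L y).re)
      (2 * (2 * ρ y * (L y).re) * (L y).re + 2 * ρ y * (deriv L y).re) y :=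
    ((dρ y).const_mul 2).mul (hasDerivAt_re (dL y))
  have eρ (y) : madRho φ y t = ρ y := rfl
  have eU (y) : madU ε φ y t = ε * (L y).im := rfl
  have eF (y) : madF φ y t = (deriv L y).re + (L y).re ^ 2 := by
    simp only [madF, eρ]
    rw [show (fun y => ρ y) = ρ from rfl, show deriv ρ = _ from funext fun y => (dρ y).deriv,
      (dρ' y).deriv]
    have := ρ0 y
    field_simp
    ring
  have hN (y) : deriv (fun y => (‖φ y t‖ : ℂ) ^ 2 * φ y t) y
      = ((2 * ρ y * (L y).re : ℝ) + ρ y * L y) * p y := by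
    have h := ((dρ y).ofReal_comp).mul (dp y)
    have e : (fun y => (‖φ y t‖ : ℂ) ^ 2 * φ y t) = (fun y => (ρ y : ℂ)) * p := by
      funext y; simp [hρ, hp]
    rw [e, h.deriv, hpL]
    ring
  have hM (y) : Complex.I * ε * (q y / p y) + (ε : ℂ) ^ 2 / 2 * (deriv L y + L y ^ 2) + ρ y
      + Complex.I * α * ε * ((2 * ρ y * (L y).re : ℝ) + ρ y * L y) = 0 := by
    have h := hq y
    rw [hN, show deriv (fun y => deriv p y) y = _ from hpp y] at h
    have e : ((‖φ y t‖ : ℂ)) ^ 2 = ρ y := by simp [hρ, hp]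
    rw [e, show φ y t = p y from rfl] at h
    apply (mul_eq_zero.1 _).resolve_right (h0 y)
    rw [← h]
    have h0' : p y ≠ 0 := h0 y
    linear_combination Complex.I * ε * div_mul_cancel₀ (q y) h0'
  have hre (y) : (q y / p y).re
      = -(deriv L y).im * (ε / 2) - ε * (L y).re * (L y).im - 3 * α * ρ y * (L y).re := by
    have h := congrArg Complex.im (hM y)
    generalize q y / p y = M at h ⊢
    simp [sq, Complex.mul_re, Complex.mul_im] at h
    have := hε.ne'
    apply mul_left_cancel₀ this
    linear_combination h
  have him (y) : (q y / p y).im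
      = ε / 2 * ((deriv L y).re + (L y).re ^ 2 - (L y).im ^ 2) + ρ y / ε
        - α * (ρ y * (L y).im) := by
    have h := congrArg Complex.re (hM y)
    generalize q y / p y = M at h ⊢
    simp [sq, Complex.mul_re, Complex.mul_im] at h
    have := hε.ne'
    field_simp
    linear_combination -2 * h
  have da := hasDerivAt_re (dL x)
  have db := hasDerivAt_im (dL x)
  have da' := hasDerivAt_re (dL' x)
  have dr := dρ x
  simp only [eρ, eU, eF, show ∀ y, φ y t = p y from fun _ => rfl, him]
  constructor
  · rw [hre, ((dr.fun_mul (db.const_mul ε)).fun_add ((dr.fun_pow 2).const_mul (3 / 2 * α))).deriv]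
    simp only [hρ]
    push_cast
    ring
  · rw [(((da'.fun_add (da.fun_pow 2)).fun_sub (db.fun_pow 2)).const_mul (ε / 2) |>.fun_add (dr.div_const ε)
        |>.fun_sub ((dr.fun_mul db).const_mul α)).deriv,
      ((((db.const_mul ε).fun_pow 2).const_mul (1 / 2)).fun_sub dr |>.fun_add
        ((dr.const_mul α).fun_mul (db.const_mul ε))).deriv,
      (da'.fun_add (da.fun_pow 2)).deriv]
    have := hε.ne'
    push_cast
    field_simp
    ring

lemma hasDerivAt_slice_fst {g : ℝ × ℝ → ℂ} {x t : ℝ} (h : DifferentiableAt ℝ g (x, t)) :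
    HasDerivAt (fun y => g (y, t)) (fderiv ℝ g (x, t) (1, 0)) x :=
  h.hasFDerivAt.comp_hasDerivAt x ((hasDerivAt_id x).prodMk (hasDerivAt_const x t))

lemma hasDerivAt_slice_snd {g : ℝ × ℝ → ℂ} {x t : ℝ} (h : DifferentiableAt ℝ g (x, t)) :
    HasDerivAt (fun τ => g (x, τ)) (fderiv ℝ g (x, t) (0, 1)) t :=
  h.hasFDerivAt.comp_hasDerivAt t ((hasDerivAt_const t x).prodMk (hasDerivAt_id t))

/-- Equality of mixed directional derivatives. -/
lemma fderiv_fderiv_apply_comm {g : ℝ × ℝ → ℂ} {z : ℝ × ℝ}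
    (h : ContDiffAt ℝ (⊤ : ℕ∞) g z) (v w : ℝ × ℝ) :
    fderiv ℝ (fun z => fderiv ℝ g z v) z w = fderiv ℝ (fun z => fderiv ℝ g z w) z v := by
  have hd : DifferentiableAt ℝ (fderiv ℝ g) z :=
    (h.fderiv_right (m := 1) (by norm_cast)).differentiableAt (by simp)
  have e (v w : ℝ × ℝ) : fderiv ℝ (fun z => fderiv ℝ g z v) z w
      = fderiv ℝ (fderiv ℝ g) z w v := by
    rw [fderiv_clm_apply hd (differentiableAt_const v)]
    simp
  rw [e, e]
  exact (h.isSymmSndFDerivAt (by simpa using (by norm_cast : (2 : WithTop ℕ∞) ≤ (⊤ : ℕ∞)))).eq w v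

/-- the MNLS equation written exactly in Madelung fluid variables. -/
theorem madelung_form_of_MNLS (ε α : ℝ) (hε : 0 < ε) (hα : 0 < α)
    (I : Set ℝ) (hIopen : IsOpen I) (hIconn : I.OrdConnected)
    (φ : ℝ → ℝ → ℂ)
    (hsmooth : ContDiffOn ℝ (⊤ : ℕ∞) (fun p : ℝ × ℝ => φ p.1 p.2) (Set.univ ×ˢ I))
    (hnz : ∀ x : ℝ, ∀ t ∈ I, φ x t ≠ 0)
    (hMNLS : ∀ x : ℝ, ∀ t ∈ I,
      Complex.I * (ε:ℂ) * deriv (fun τ => φ x τ) t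
        + ((ε:ℂ)^2/2) * deriv (fun y => deriv (fun y' => φ y' t) y) x
        + (‖φ x t‖ : ℂ)^2 * φ x t
        + Complex.I * (α:ℂ) * (ε:ℂ) *
            deriv (fun y => (‖φ y t‖ : ℂ)^2 * φ y t) x = 0) :
    ∀ x : ℝ, ∀ t ∈ I,
      (deriv (fun τ => madRho φ x τ) t
        + deriv (fun y => madRho φ y t * madU ε φ y t + (3/2)*α*(madRho φ y t)^2) x = 0) ∧
      (deriv (fun τ => madU ε φ x τ) t
        + deriv (fun y => (1/2)*(madU ε φ y t)^2 - madRho φ y t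
            + α*(madRho φ y t)*(madU ε φ y t)) x
        = (ε^2/2) * deriv (fun y => madF φ y t) x) := by
  intro x t ht
  set g : ℝ × ℝ → ℂ := fun p => φ p.1 p.2 with hg
  have hU : IsOpen ((Set.univ : Set ℝ) ×ˢ I) := isOpen_univ.prod hIopen
  have hs (y τ : ℝ) (hτ : τ ∈ I) : ContDiffAt ℝ (⊤ : ℕ∞) g (y, τ) :=
    hsmooth.contDiffAt (hU.mem_nhds ⟨Set.mem_univ _, hτ⟩)
  have hd (y τ : ℝ) (hτ : τ ∈ I) : DifferentiableAt ℝ g (y, τ) :=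
    (hs y τ hτ).differentiableAt (by simp)
  have hd' (y τ : ℝ) (hτ : τ ∈ I) (v : ℝ × ℝ) :
      DifferentiableAt ℝ (fun z => fderiv ℝ g z v) (y, τ) :=
    (((hs y τ hτ).fderiv_right (m := 1) (by norm_cast)).differentiableAt (by simp)).clm_apply
      (differentiableAt_const v)
  have dx (y τ : ℝ) (hτ : τ ∈ I) : HasDerivAt (fun y => φ y τ) (fderiv ℝ g (y, τ) (1, 0)) y :=
    hasDerivAt_slice_fst (hd y τ hτ)
  have dt (y τ : ℝ) (hτ : τ ∈ I) : HasDerivAt (fun τ => φ y τ) (fderiv ℝ g (y, τ) (0, 1)) τ :=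
    hasDerivAt_slice_snd (hd y τ hτ)
  have hslice : ContDiff ℝ (⊤ : ℕ∞) (fun y => φ y t) := contDiff_iff_contDiffAt.2 fun y =>
    (hs y t ht).comp y (contDiffAt_id.prodMk contDiffAt_const)
  have key := madelung_slice (q := fun y => fderiv ℝ g (y, t) (0, 1)) hε hslice
    (fun y => hnz y t ht) (fun y => by rw [← (dt y t ht).deriv]; exact hMNLS y t ht) x
  have hρ : deriv (fun τ => madRho φ x τ) t
      = 2 * ‖φ x t‖ ^ 2 * (fderiv ℝ g (x, t) (0, 1) / φ x t).re :=
    (hasDerivAt_norm_sq_of_ne_zero (dt x t ht) (hnz x t ht)).deriv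
  have hu : deriv (fun τ => madU ε φ x τ) t
      = ε * deriv (fun y => (fderiv ℝ g (y, t) (0, 1) / φ y t).im) x := by
    have e : (fun τ => madU ε φ x τ) =ᶠ[𝓝 t]
        fun τ => ε * (fderiv ℝ g (x, τ) (1, 0) / φ x τ).im := by
      filter_upwards [hIopen.mem_nhds ht] with τ hτ
      rw [madU, (dx x τ hτ).deriv]
    have h1 := (hasDerivAt_im ((hasDerivAt_slice_snd (hd' x t ht (1, 0))).div (dt x t ht)
      (hnz x t ht))).const_mul ε
    have h2 := hasDerivAt_im ((hasDerivAt_slice_fst (hd' x t ht (0, 1))).div (dx x t ht)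
      (hnz x t ht))
    rw [e.deriv_eq]
    refine h1.deriv.trans ?_
    refine Eq.trans ?_ (congrArg (ε * ·) h2.deriv.symm)
    rw [fderiv_fderiv_apply_comm (hs x t ht) (1, 0) (0, 1)]
    simp only [mul_comm (fderiv ℝ g (x, t) (1, 0))]
  rw [hρ, hu]
  exact key
end
end

section
/- For every real z ≠ 0, the squared modulus of the reflection coefficient satisfies |s(z)|² = |cosh²(πμ/(2ε)) − cosh²(πR(z)/(2iε))| / (cosh²(πΩ(z)/(iε)) + cosh²(πR(z)/(2iε)) − 1), and moreover |s(z)|² = sgn(z)·(cosh²(πμ/(2ε)) − cosh²(πR(z)/(2iε))) / (cosh²(πΩ(z)/(iε)) + cosh²(πR(z)/(2iε)) − 1). -/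
open Complex Real Filter Set MeasureTheory ComplexConjugate Topology

noncomputable section

/-- The inverse hyperbolic tangent. -/
def arctanh (x : ℝ) : ℝ := Real.log ((1 + x) / (1 - x)) / 2

/-- The hyperbolic secant. -/
def sech (x : ℝ) : ℝ := 1 / Real.cosh x

/-- The point `z_P = (1-αδ+αμ)/4`. -/
def zP (α δ μ : ℝ) : ℝ := (1 - α*δ + α*μ)/4

/-- The point `z_∞ = (1-αδ-αμ)/4`. -/
def zInf (α δ μ : ℝ) : ℝ := (1 - α*δ - α*μ)/4

/-- The discriminant `α⁴ + α²μ²/4 − α²(1−αδ)`. -/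
def discrm (α δ μ : ℝ) : ℝ := α^4 + α^2*μ^2/4 - α^2*(1 - α*δ)

/-- The point `z⁺`. -/
def zplus (α δ μ : ℝ) : ℝ := (1/2)*((1 - α*δ)/2 - α^2 + Real.sqrt (discrm α δ μ))

/-- The point `z⁻ = z_L`. -/
def zminus (α δ μ : ℝ) : ℝ := (1/2)*((1 - α*δ)/2 - α^2 - Real.sqrt (discrm α δ μ))

/-- `Ω(z) = (2/(iα))(z − (1−αδ)/4)`. -/
def Omg (α δ : ℝ) (z : ℂ) : ℂ := (2 / (Complex.I * α)) * (z - (1 - α * δ) / 4)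

/-- `R(z) = e^{iπ/4}(−i(16z−μ²))^{1/2}` (principal branch). -/
def Rf (μ : ℝ) (z : ℂ) : ℂ :=
  Complex.exp (Complex.I * (π : ℂ) / 4) * (-Complex.I * (16 * z - (μ:ℂ)^2)) ^ ((1:ℂ)/2)

/-- The reflection coefficient `s(z)` (Gamma-function formula). -/
def sRef (α δ μ ε : ℝ) (z : ℂ) : ℂ :=
  -(((2:ℂ) ^ (-(Complex.I * (μ:ℂ)) / (ε:ℂ)) * Complex.I * (ε:ℂ)) /
      (2 * Complex.exp (Complex.I * (π : ℂ) / 4) * (-Complex.I * z) ^ ((1:ℂ)/2))) *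
    (Complex.Gamma (1/2 - Complex.I * (μ:ℂ) / (2*ε) - Omg α δ z / ε) /
      Complex.Gamma (1/2 + Complex.I * (μ:ℂ) / (2*ε) + Omg α δ z / ε)) *
    ((Complex.Gamma (1/2 + Omg α δ z / ε - Rf μ z / (2*ε)) *
      Complex.Gamma (1/2 + Omg α δ z / ε + Rf μ z / (2*ε))) /
      (Complex.Gamma (-(Complex.I * (μ:ℂ)) / (2*ε) - Rf μ z / (2*ε)) *
        Complex.Gamma (-(Complex.I * (μ:ℂ)) / (2*ε) + Rf μ z / (2*ε))))

/-- Euler's reflection formula in the form `Γ(x)Γ(-x) = -π / (x sin πx)`. -/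
lemma Gamma_mul_Gamma_neg {x : ℂ} (hx : x ≠ 0) :
    Complex.Gamma x * Complex.Gamma (-x) = -π / (x * Complex.sin (π * x)) := by
  have h := Complex.Gamma_mul_Gamma_one_sub x
  have h1 : Complex.Gamma (1 - x) = -x * Complex.Gamma (-x) := by
    rw [← Complex.Gamma_add_one _ (neg_ne_zero.mpr hx)]
    ring_nf
  rw [h1] at h
  calc Complex.Gamma x * Complex.Gamma (-x)
      = -(Complex.Gamma x * (-x * Complex.Gamma (-x))) / x := by field_simp
    _ = -π / (x * Complex.sin (π * x)) := by
      rw [h, ← neg_div, div_div, mul_comm x]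

/-- If `ρ` is real or purely imaginary, conjugation permutes the arguments `a ± ρ`. -/
lemma norm_sq_Gamma_mul_Gamma {ρ : ℂ} (hρ : conj ρ = ρ ∨ conj ρ = -ρ) (a : ℂ) :
    ((‖Complex.Gamma (a - ρ) * Complex.Gamma (a + ρ)‖ : ℝ) : ℂ) ^ 2
      = (Complex.Gamma (a + ρ) * Complex.Gamma (conj a - ρ))
        * (Complex.Gamma (a - ρ) * Complex.Gamma (conj a + ρ)) := by
  rw [← Complex.mul_conj', map_mul, ← Complex.Gamma_conj, ← Complex.Gamma_conj, map_sub, map_add]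
  rcases hρ with h | h <;> rw [h]
  · ring
  · rw [sub_neg_eq_add, ← sub_eq_add_neg]
    ring

lemma norm_sq_Gamma_half {ρ : ℂ} (hρ : conj ρ = ρ ∨ conj ρ = -ρ) (b : ℝ) :
    ((‖Complex.Gamma (1 / 2 + b * I - ρ) * Complex.Gamma (1 / 2 + b * I + ρ)‖ : ℝ) : ℂ) ^ 2
      = π ^ 2 / (Complex.cosh (π * b) ^ 2 + Complex.cos (π * ρ) ^ 2 - 1) := by
  have hconj : conj (1 / 2 + b * I : ℂ) = 1 / 2 - b * I := by
    simp [sub_eq_add_neg, map_ofNat]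
  have hsin (t : ℂ) : Complex.sin (π * (1 / 2 + t)) = Complex.cos (π * t) := by
    rw [← Complex.sin_add_pi_div_two]
    ring_nf
  rw [norm_sq_Gamma_mul_Gamma hρ, hconj,
    show (1 / 2 - b * I - ρ : ℂ) = 1 - (1 / 2 + b * I + ρ) by ring,
    show (1 / 2 - b * I + ρ : ℂ) = 1 - (1 / 2 + b * I - ρ) by ring,
    Complex.Gamma_mul_Gamma_one_sub, Complex.Gamma_mul_Gamma_one_sub, div_mul_div_comm, ← sq,
    add_assoc, add_sub_assoc, hsin, hsin,
    show (π : ℂ) * (b * I + ρ) = π * ρ + (π * b) * I by ring,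
    show (π : ℂ) * (b * I - ρ) = -(π * ρ - (π * b) * I) by ring,
    Complex.cos_neg, Complex.cos_add, Complex.cos_sub, Complex.cos_mul_I, Complex.sin_mul_I]
  congr 1
  linear_combination (Complex.cosh (π * b) ^ 2 - 1) * Complex.sin_sq_add_cos_sq (π * ρ)
    + Complex.sin (π * ρ) ^ 2 * (-Complex.cosh_sq_sub_sinh_sq (π * b))
    - Complex.sin (π * ρ) ^ 2 * Complex.sinh (π * b) ^ 2 * Complex.I_sq

lemma norm_sq_Gamma_imag {ρ : ℂ} (hρ : conj ρ = ρ ∨ conj ρ = -ρ) (m : ℝ)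
    (h0 : ρ ^ 2 + (m : ℂ) ^ 2 ≠ 0) :
    ((‖Complex.Gamma (-(m * I) - ρ) * Complex.Gamma (-(m * I) + ρ)‖ : ℝ) : ℂ) ^ 2
      = π ^ 2 / ((ρ ^ 2 + (m : ℂ) ^ 2)
          * (Complex.cosh (π * m) ^ 2 - Complex.cos (π * ρ) ^ 2)) := by
  have hconj : conj (-(m * I) : ℂ) = m * I := by simp
  have hfac : (ρ - m * I) * (ρ + m * I) = ρ ^ 2 + (m : ℂ) ^ 2 := by
    linear_combination -(m : ℂ) ^ 2 * Complex.I_sq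
  rw [← hfac] at h0
  rw [norm_sq_Gamma_mul_Gamma hρ, hconj,
    show (-(m * I) + ρ : ℂ) = ρ - m * I by ring,
    show (m * I - ρ : ℂ) = -(ρ - m * I) by ring,
    show (-(m * I) - ρ : ℂ) = -(ρ + m * I) by ring,
    show (m * I + ρ : ℂ) = ρ + m * I by ring,
    Gamma_mul_Gamma_neg (left_ne_zero_of_mul h0), mul_comm (Complex.Gamma (-(ρ + m * I))),
    Gamma_mul_Gamma_neg (right_ne_zero_of_mul h0), div_mul_div_comm, neg_mul_neg, ← sq,
    mul_mul_mul_comm, hfac,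
    show (π : ℂ) * (ρ - m * I) = π * ρ - (π * m) * I by ring,
    show (π : ℂ) * (ρ + m * I) = π * ρ + (π * m) * I by ring,
    Complex.sin_add, Complex.sin_sub, Complex.cos_mul_I, Complex.sin_mul_I]
  congr 2
  linear_combination Complex.cosh (π * m) ^ 2 * Complex.sin_sq_add_cos_sq (π * ρ)
    - Complex.cos (π * ρ) ^ 2 * Complex.cosh_sq_sub_sinh_sq (π * m)
    - Complex.cos (π * ρ) ^ 2 * Complex.sinh (π * m) ^ 2 * Complex.I_sq

lemma cpow_half_sq (w : ℂ) : (w ^ ((1 : ℂ) / 2)) ^ 2 = w := by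
  simp [one_div]

lemma Rf_sq (μ : ℝ) (z : ℂ) : Rf μ z ^ 2 = 16 * z - (μ : ℂ) ^ 2 := by
  have hexp : Complex.exp (I * π / 4) ^ 2 = I := by
    rw [← Complex.exp_nat_mul, show ((2 : ℕ) : ℂ) * (I * π / 4) = π / 2 * I by push_cast; ring,
      Complex.exp_pi_div_two_mul_I]
  rw [Rf, mul_pow, cpow_half_sq, hexp]
  linear_combination -(16 * z - (μ : ℂ) ^ 2) * Complex.I_sq

/-- On the real axis, `R` is real or purely imaginary. -/
lemma conj_Rf (μ z : ℝ) : conj (Rf μ z) = Rf μ z ∨ conj (Rf μ z) = -Rf μ z := by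
  rw [← sq_eq_sq_iff_eq_or_eq_neg, ← map_pow, Rf_sq]
  simp [map_ofNat]

lemma Omg_ofReal (α δ z : ℝ) :
    Omg α δ z = ((-(2 / α * (z - (1 - α * δ) / 4)) : ℝ) : ℂ) * I := by
  rw [Omg, ← div_div, div_eq_mul_inv (2 : ℂ) I, Complex.inv_I]
  push_cast
  ring

/-- `Γ(1/2 - ia) / Γ(1/2 + ia)` is unimodular for real `a`. -/
lemma norm_Gamma_half_div (a : ℝ) :
    ‖Complex.Gamma (1 / 2 - a * I) / Complex.Gamma (1 / 2 + a * I)‖ = 1 := by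
  have hconj : (1 / 2 - a * I : ℂ) = conj (1 / 2 + a * I : ℂ) := by
    simp [sub_eq_add_neg, map_ofNat]
  have hre : 0 < (1 / 2 + a * I : ℂ).re := by simp
  rw [hconj, Complex.Gamma_conj, norm_div, Complex.norm_conj,
    div_self (norm_ne_zero_iff.mpr (Complex.Gamma_ne_zero_of_re_pos hre))]

lemma norm_sq_sRef_prefactor (μ ε z : ℝ) :
    ‖-(((2 : ℂ) ^ (-(I * (μ : ℂ)) / (ε : ℂ)) * I * (ε : ℂ)) /
      (2 * Complex.exp (I * (π : ℂ) / 4) * (-I * (z : ℂ)) ^ ((1 : ℂ) / 2)))‖ ^ 2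
      = ε ^ 2 / (4 * |z|) := by
  have h2 : ‖(2 : ℂ) ^ (-(I * (μ : ℂ)) / (ε : ℂ))‖ = 1 := by
    have h := Complex.norm_cpow_eq_rpow_re_of_pos (x := 2) two_pos (-(I * (μ : ℂ)) / (ε : ℂ))
    rw [Complex.ofReal_ofNat] at h
    rw [h, Complex.div_ofReal_re]
    simp
  have hexp : ‖Complex.exp (I * (π : ℂ) / 4)‖ = 1 := by
    rw [Complex.norm_exp, Complex.div_ofNat_re]
    simp
  have hroot : ‖(-I * (z : ℂ)) ^ ((1 : ℂ) / 2)‖ ^ 2 = |z| := by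
    rw [← norm_pow, cpow_half_sq]
    simp
  rw [norm_neg, norm_div, norm_mul, norm_mul, norm_mul, norm_mul, h2, hexp, div_pow, mul_pow, mul_pow, mul_pow, mul_pow,
    hroot]
  norm_num

/-- exact formula for `|s(z)|²` on the real axis. -/
theorem modulus_squared_reflection_formula (α δ μ ε : ℝ) (hα : 0 < α) (hε : 0 < ε)
    (z : ℝ) (hz : z ≠ 0) :
    (‖sRef α δ μ ε (z:ℂ)‖^2 : ℂ)
        = ‖Complex.cosh ((π:ℂ) * (μ:ℂ) / (2*ε))^2
            - Complex.cosh ((π:ℂ) * Rf μ (z:ℂ) / (2*Complex.I*ε))^2‖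
          / (Complex.cosh ((π:ℂ) * Omg α δ (z:ℂ) / (Complex.I*ε))^2
              + Complex.cosh ((π:ℂ) * Rf μ (z:ℂ) / (2*Complex.I*ε))^2 - 1) ∧
    (‖sRef α δ μ ε (z:ℂ)‖^2 : ℂ)
        = (Real.sign z : ℂ) * (Complex.cosh ((π:ℂ) * (μ:ℂ) / (2*ε))^2
            - Complex.cosh ((π:ℂ) * Rf μ (z:ℂ) / (2*Complex.I*ε))^2)
          / (Complex.cosh ((π:ℂ) * Omg α δ (z:ℂ) / (Complex.I*ε))^2
              + Complex.cosh ((π:ℂ) * Rf μ (z:ℂ) / (2*Complex.I*ε))^2 - 1) := by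
  have hε' : (ε : ℂ) ≠ 0 := by exact_mod_cast hε.ne'
  have hz' : (z : ℂ) ≠ 0 := by exact_mod_cast hz
  obtain ⟨b, m, hb, hm⟩ : ∃ b m : ℝ, b = -(2 / α * (z - (1 - α * δ) / 4)) / ε ∧ m = μ / (2 * ε) :=
    ⟨_, _, rfl, rfl⟩
  obtain ⟨ρ, hρ⟩ : ∃ ρ : ℂ, ρ = Rf μ z / (2 * ε) := ⟨_, rfl⟩
  have hΩ : Omg α δ z / ε = b * I := by
    rw [Omg_ofReal, hb]
    push_cast
    ring
  have hμ : I * (μ : ℂ) / (2 * ε) = m * I := by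
    rw [hm]
    push_cast
    ring
  have hρconj : conj ρ = ρ ∨ conj ρ = -ρ := by
    have hden : conj (2 * ε : ℂ) = 2 * ε := by simp [map_ofNat]
    rw [hρ, map_div₀, hden, ← neg_div]
    exact (conj_Rf μ z).imp (fun h => by rw [h]) (fun h => by rw [h])
  have hsum : ρ ^ 2 + (m : ℂ) ^ 2 = 4 * z / ε ^ 2 := by
    rw [hρ, hm, div_pow, Rf_sq]
    push_cast
    field_simp
    ring
  have hsum0 : ρ ^ 2 + (m : ℂ) ^ 2 ≠ 0 := by
    rw [hsum]
    exact div_ne_zero (mul_ne_zero (by norm_num) hz') (pow_ne_zero _ hε')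
  have hcR : Complex.cosh ((π : ℂ) * Rf μ z / (2 * I * ε)) = Complex.cos (π * ρ) := by
    rw [← Complex.cosh_mul_I, ← Complex.cosh_neg, hρ]
    congr 1
    field_simp
    linear_combination -Rf μ z * Complex.I_sq
  have hcΩ : (π : ℂ) * Omg α δ z / (I * ε) = π * b := by
    rw [mul_comm I, ← div_div, mul_div_assoc, hΩ]
    field_simp
  have hcμ : (π : ℂ) * (μ : ℂ) / (2 * ε) = π * m := by
    rw [hm]
    push_cast
    ring
  have hN := norm_sq_Gamma_half hρconj b
  have hD := norm_sq_Gamma_imag hρconj m hsum0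
  have hs : ((‖sRef α δ μ ε z‖ : ℝ) : ℂ) ^ 2
      = ((ε ^ 2 / (4 * |z|) : ℝ) : ℂ)
        * ((π ^ 2 / (Complex.cosh (π * b) ^ 2 + Complex.cos (π * ρ) ^ 2 - 1))
          / (π ^ 2 / ((ρ ^ 2 + (m : ℂ) ^ 2)
            * (Complex.cosh (π * m) ^ 2 - Complex.cos (π * ρ) ^ 2)))) := by
    rw [← hN, ← hD, ← norm_sq_sRef_prefactor μ ε z, sRef, norm_mul, norm_mul, norm_div (_ * _),
      neg_div (2 * (ε : ℂ)) (I * (μ : ℂ)), hμ, hΩ, ← hρ,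
      show (1 / 2 - m * I - b * I : ℂ) = 1 / 2 - ((m + b : ℝ) : ℂ) * I by push_cast; ring,
      show (1 / 2 + m * I + b * I : ℂ) = 1 / 2 + ((m + b : ℝ) : ℂ) * I by push_cast; ring,
      norm_Gamma_half_div]
    push_cast
    ring
  rw [hcR, hcΩ, hcμ]
  have hπ : (π : ℂ) ≠ 0 := by exact_mod_cast Real.pi_ne_zero
  have habs : (z : ℂ) / (|z| : ℝ) = (Real.sign z : ℂ) := by
    rcases lt_or_gt_of_ne hz with h | h
    · rw [abs_of_neg h, Real.sign_of_neg h]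
      push_cast
      field_simp
    · rw [abs_of_pos h, Real.sign_of_pos h]
      push_cast
      field_simp
  have habs0 : ((|z| : ℝ) : ℂ) ≠ 0 := by exact_mod_cast abs_ne_zero.mpr hz
  have hsgn : (Real.sign z : ℂ) * (Complex.cosh (π * m) ^ 2 - Complex.cos (π * ρ) ^ 2)
      = ((π ^ 2 * ε ^ 2 / (4 * |z|)
        * (‖Complex.Gamma (-(m * I) - ρ) * Complex.Gamma (-(m * I) + ρ)‖ ^ 2)⁻¹ : ℝ) : ℂ) := by
    push_cast
    rw [hD, hsum, ← habs, inv_div]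
    field_simp
  have hnorm : ((‖Complex.cosh (π * m) ^ 2 - Complex.cos (π * ρ) ^ 2‖ : ℝ) : ℂ)
      = (Real.sign z : ℂ) * (Complex.cosh (π * m) ^ 2 - Complex.cos (π * ρ) ^ 2) := by
    have hone : ‖(Real.sign z : ℂ)‖ = 1 := by
      rcases lt_or_gt_of_ne hz with h | h
      · simp [Real.sign_of_neg h]
      · simp [Real.sign_of_pos h]
    rw [← one_mul ‖_‖, ← hone, ← norm_mul, hsgn, Complex.norm_of_nonneg (by positivity)]
  rw [hnorm, and_self, hs, hsum, ← habs]
  push_cast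
  rw [div_div_eq_mul_div]
  field_simp
end
end

section
/- Assume (T1) α|μ| > |1−αδ|, (T2) μ² > 4(1−αδ), (T3) μ > 0. Define τ(z) := π√(μ²−16z) + (4π/α)(z − (1−αδ)/4) for z_L < z ≤ z_∞ and τ(z) := π√(μ²−16z) − πμ for z_∞ ≤ z < 0. Then for each η > 0 there exist constants c > 0, C > 0 and ε₀ > 0 such that for all ε ∈ (0,ε₀] and all z ∈ [z_L+η, z_∞−η] ∪ [z_∞+η, 0], one has |(1 − |s(z)|²)·e^{τ(z)/ε} − 1| ≤ C·e^{−c/ε}. -/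
open Complex Real Filter Set MeasureTheory ComplexConjugate Topology

noncomputable section

/-- The exponent `τ(z)` on `(z_L, 0)`, with break point `z_∞`. -/
def tauF (α δ μ : ℝ) (z : ℝ) : ℝ :=
  if z ≤ zInf α δ μ then π*Real.sqrt (μ^2 - 16*z) + (4*π/α)*(z - (1 - α*δ)/4)
  else π*Real.sqrt (μ^2 - 16*z) - π*μ

theorem norm_Gamma_half_add_mul_I_sq (t : ℝ) :
    ‖Complex.Gamma (1 / 2 + t * Complex.I)‖ ^ 2 = π / Real.cosh (π * t) := by
  have h := Complex.Gamma_mul_Gamma_one_sub (1 / 2 + t * Complex.I)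
  have hc : 1 - (1 / 2 + t * Complex.I) = conj (1 / 2 + t * Complex.I) := by
    apply Complex.ext <;> simp
    norm_num
  have hs : Complex.sin (π * (1 / 2 + t * Complex.I)) = (Real.cosh (π * t) : ℝ) := by
    rw [show (π : ℂ) * (1 / 2 + t * Complex.I) = (π * t : ℂ) * Complex.I + π / 2 by ring,
      Complex.sin_add_pi_div_two, Complex.cos_mul_I]
    push_cast; rfl
  rw [hc, Complex.Gamma_conj, Complex.mul_conj, hs, Complex.normSq_eq_norm_sq] at h
  exact_mod_cast h

theorem norm_Gamma_mul_I_sq {t : ℝ} (ht : t ≠ 0) :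
    ‖Complex.Gamma (t * Complex.I)‖ ^ 2 = π / (t * Real.sinh (π * t)) := by
  have h := Complex.Gamma_mul_Gamma_one_sub (t * Complex.I)
  have hc : 1 - (t * Complex.I) = conj (t * Complex.I) + 1 := by
    simp; ring
  have hne : conj (t * Complex.I) ≠ 0 := by simp [ht]
  have hs : Complex.sin (π * (t * Complex.I)) = (Real.sinh (π * t) : ℝ) * Complex.I := by
    rw [← mul_assoc, Complex.sin_mul_I]
    push_cast; rfl
  rw [hc, Complex.Gamma_add_one _ hne, Complex.Gamma_conj, hs, mul_left_comm, Complex.mul_conj,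
    Complex.normSq_eq_norm_sq] at h
  have hsinh : Real.sinh (π * t) ≠ 0 := by
    simp [Real.sinh_eq_zero, ht, Real.pi_ne_zero]
  have hsinh' : ((Real.sinh (π * t) : ℝ) : ℂ) ≠ 0 := by exact_mod_cast hsinh
  rw [map_mul, Complex.conj_I, Complex.conj_ofReal, eq_div_iff (mul_ne_zero hsinh' Complex.I_ne_zero)] at h
  have h2 : ((t * ‖Complex.Gamma (t * Complex.I)‖ ^ 2 * Real.sinh (π * t) : ℝ) : ℂ) = (π : ℝ) := by
    rw [← h]; push_cast; linear_combination ((t : ℂ) * ‖Complex.Gamma (t * Complex.I)‖ ^ 2 *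
      (Complex.sinh (π * t))) * Complex.I_sq
  have h3 := Complex.ofReal_injective h2
  rw [eq_div_iff (mul_ne_zero ht hsinh)]
  linarith

theorem I_mul_cpow_half {x : ℝ} (hx : 0 ≤ x) :
    (Complex.I * (x : ℂ)) ^ ((1 : ℂ) / 2) =
      Complex.exp (Complex.I * (π : ℂ) / 4) * (Real.sqrt x : ℝ) := by
  rcases hx.eq_or_lt with rfl | hx0
  · simp
  have hx1 : (x : ℂ) ≠ 0 := by exact_mod_cast hx0.ne'
  have hlog : Complex.log (Complex.I * (x : ℂ)) = (Real.log x : ℝ) + (π : ℂ) / 2 * Complex.I := by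
    rw [mul_comm, Complex.log_ofReal_mul hx0 Complex.I_ne_zero, Complex.log_I]
  rw [Complex.cpow_def_of_ne_zero (mul_ne_zero Complex.I_ne_zero hx1), hlog, Real.sqrt_eq_rpow,
    Real.rpow_def_of_pos hx0, Complex.ofReal_exp, ← Complex.exp_add]
  congr 1
  push_cast
  ring

theorem Rf_ofReal {μ z : ℝ} (h : 0 ≤ μ ^ 2 - 16 * z) :
    Rf μ z = (Real.sqrt (μ ^ 2 - 16 * z) : ℝ) * Complex.I := by
  have h1 : -Complex.I * (16 * (z : ℂ) - (μ : ℂ) ^ 2) =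
      Complex.I * ((μ ^ 2 - 16 * z : ℝ) : ℂ) := by push_cast; ring
  have h2 : Complex.exp (Complex.I * (π : ℂ) / 4) * Complex.exp (Complex.I * (π : ℂ) / 4) =
      Complex.I := by
    rw [← Complex.exp_add, ← add_div,
      show (Complex.I * (π : ℂ) + Complex.I * π) / 4 = π / 2 * Complex.I by ring,
      Complex.exp_pi_div_two_mul_I]
  rw [Rf, h1, I_mul_cpow_half h, ← mul_assoc, h2, mul_comm]

theorem norm_Gamma_half_sub_div_Gamma_half_add (t : ℝ) :
    ‖Complex.Gamma (1 / 2 + (-t : ℝ) * Complex.I) / Complex.Gamma (1 / 2 + t * Complex.I)‖ = 1 := by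
  have hc : 1 / 2 + ((-t : ℝ) : ℂ) * Complex.I = conj (1 / 2 + t * Complex.I) := by
    apply Complex.ext <;> simp
  have hne : Complex.Gamma (1 / 2 + t * Complex.I) ≠ 0 :=
    Complex.Gamma_ne_zero_of_re_pos (by simp)
  rw [hc, Complex.Gamma_conj, norm_div, RCLike.norm_conj, div_self (norm_ne_zero_iff.2 hne)]

theorem norm_sRef_sq {α δ μ ε z : ℝ} (hμ : 0 < μ) (hε : 0 < ε) (hz : z ≤ 0) :
    ‖sRef α δ μ ε (z : ℂ)‖ ^ 2 =
      (Real.cosh (π * Real.sqrt (μ ^ 2 - 16 * z) / ε) - Real.cosh (π * μ / ε)) /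
        (Real.cosh (π * (4 / α * (z - (1 - α * δ) / 4)) / ε) +
          Real.cosh (π * Real.sqrt (μ ^ 2 - 16 * z) / ε)) := by
  rcases hz.eq_or_lt with rfl | hz
  · simp [sRef, Real.sqrt_sq hμ.le]
  set ρ := Real.sqrt (μ ^ 2 - 16 * z) with hρ
  set ω := 2 / α * (z - (1 - α * δ) / 4) with hω
  have hρsq : ρ ^ 2 = μ ^ 2 - 16 * z := Real.sq_sqrt (by nlinarith)
  have hρμ : μ < ρ := Real.lt_sqrt_of_sq_lt (by linarith)
  have hO : Omg α δ z = -(ω : ℂ) * Complex.I := by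
    rw [Omg, hω, mul_comm Complex.I, ← div_div, Complex.div_I]; push_cast; ring
  have hR : Rf μ z = (ρ : ℂ) * Complex.I := Rf_ofReal (by nlinarith)
  have hz' : -Complex.I * (z : ℂ) = Complex.I * ((-z : ℝ) : ℂ) := by push_cast; ring
  have hpre : ‖-(((2:ℂ) ^ (-(Complex.I * (μ:ℂ)) / (ε:ℂ)) * Complex.I * (ε:ℂ)) /
      (2 * Complex.exp (Complex.I * (π : ℂ) / 4) * (-Complex.I * z) ^ ((1:ℂ)/2)))‖ ^ 2 =
      ε ^ 2 / (4 * -z) := by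
    have e1 : ‖(2:ℂ) ^ (-(Complex.I * (μ:ℂ)) / (ε:ℂ))‖ = 1 := by
      have := Complex.norm_cpow_eq_rpow_re_of_pos (x := 2) two_pos (-(Complex.I * (μ:ℂ)) / (ε:ℂ))
      rw [Complex.div_ofReal_re] at this
      simpa using this
    have e2 : ‖Complex.exp (Complex.I * (π : ℂ) / 4)‖ = 1 := by
      rw [Complex.norm_exp]; simp
    rw [hz', I_mul_cpow_half (by linarith)]
    simp only [norm_neg, norm_div, norm_mul, e1, e2, Complex.norm_I, Complex.norm_real,
      Real.norm_eq_abs, abs_of_pos hε, abs_of_nonneg (Real.sqrt_nonneg _), Complex.norm_ofNat]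
    rw [div_pow, mul_pow, mul_pow, mul_pow, mul_pow, mul_pow, Real.sq_sqrt (by linarith)]
    norm_num
  have a1 : 1/2 - Complex.I * (μ:ℂ) / (2*ε) - Omg α δ z / ε =
      1 / 2 + ((-(μ / (2 * ε) - ω / ε) : ℝ) : ℂ) * Complex.I := by
    rw [hO]; push_cast; ring
  have a2 : 1/2 + Complex.I * (μ:ℂ) / (2*ε) + Omg α δ z / ε =
      1 / 2 + ((μ / (2 * ε) - ω / ε : ℝ) : ℂ) * Complex.I := by
    rw [hO]; push_cast; ring
  have a3 : 1/2 + Omg α δ z / ε - Rf μ z / (2*ε) =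
      1 / 2 + ((-ω / ε - ρ / (2 * ε) : ℝ) : ℂ) * Complex.I := by
    rw [hO, hR]; push_cast; ring
  have a4 : 1/2 + Omg α δ z / ε + Rf μ z / (2*ε) =
      1 / 2 + ((-ω / ε + ρ / (2 * ε) : ℝ) : ℂ) * Complex.I := by
    rw [hO, hR]; push_cast; ring
  have a5 : -(Complex.I * (μ:ℂ)) / (2*ε) - Rf μ z / (2*ε) =
      ((-(μ + ρ) / (2 * ε) : ℝ) : ℂ) * Complex.I := by
    rw [hR]; push_cast; ring
  have a6 : -(Complex.I * (μ:ℂ)) / (2*ε) + Rf μ z / (2*ε) =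
      (((ρ - μ) / (2 * ε) : ℝ) : ℂ) * Complex.I := by
    rw [hR]; push_cast; ring
  have p1 : -(μ + ρ) / (2 * ε) ≠ 0 := (div_neg_of_neg_of_pos (by linarith) (by linarith)).ne
  have p2 : (ρ - μ) / (2 * ε) ≠ 0 := (div_pos (by linarith) (by linarith)).ne'
  have c1 : Real.cosh (π * ρ / ε) - Real.cosh (π * μ / ε) =
      -(2 * Real.sinh (π * (-(μ + ρ) / (2 * ε))) * Real.sinh (π * ((ρ - μ) / (2 * ε)))) := by
    rw [show π * ρ / ε = -(π * (-(μ + ρ) / (2 * ε))) + π * ((ρ - μ) / (2 * ε)) by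
        field_simp; ring,
      show π * μ / ε = -(π * (-(μ + ρ) / (2 * ε))) - π * ((ρ - μ) / (2 * ε)) by
        field_simp; ring,
      Real.cosh_add, Real.cosh_sub, Real.sinh_neg]
    ring
  have c2 : Real.cosh (π * (4 / α * (z - (1 - α * δ) / 4)) / ε) + Real.cosh (π * ρ / ε) =
      2 * Real.cosh (π * (-ω / ε - ρ / (2 * ε))) * Real.cosh (π * (-ω / ε + ρ / (2 * ε))) := by
    rw [show π * (4 / α * (z - (1 - α * δ) / 4)) / ε =
        -(π * (-ω / ε - ρ / (2 * ε)) + π * (-ω / ε + ρ / (2 * ε))) by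
        rw [hω]; ring,
      show π * ρ / ε = -(π * (-ω / ε - ρ / (2 * ε)) - π * (-ω / ε + ρ / (2 * ε))) by
        field_simp; ring,
      Real.cosh_neg, Real.cosh_neg, Real.cosh_add, Real.cosh_sub]
    ring
  have hq : -(μ + ρ) / (2 * ε) * ((ρ - μ) / (2 * ε)) * (ε ^ 2 / (4 * -z)) = -1 := by
    have hz0 : z ≠ 0 := hz.ne
    field_simp
    nlinarith
  rw [sRef, norm_mul, norm_mul, mul_pow, mul_pow, hpre, a1, a2, a3, a4, a5, a6,
    norm_Gamma_half_sub_div_Gamma_half_add, norm_div, norm_mul, norm_mul, div_pow, mul_pow, mul_pow,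
    norm_Gamma_half_add_mul_I_sq, norm_Gamma_half_add_mul_I_sq, norm_Gamma_mul_I_sq p1,
    norm_Gamma_mul_I_sq p2, c1, c2]
  generalize -(μ + ρ) / (2 * ε) = y₁ at *
  generalize (ρ - μ) / (2 * ε) = y₂ at *
  generalize ε ^ 2 / (4 * -z) = k at *
  have hs1 : Real.sinh (π * y₁) ≠ 0 := by simp [Real.sinh_eq_zero, p1, Real.pi_ne_zero]
  have hs2 : Real.sinh (π * y₂) ≠ 0 := by simp [Real.sinh_eq_zero, p2, Real.pi_ne_zero]
  have hC1 := (Real.cosh_pos (π * (-ω / ε - ρ / (2 * ε)))).ne'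
  have hC2 := (Real.cosh_pos (π * (-ω / ε + ρ / (2 * ε)))).ne'
  generalize Real.cosh (π * (-ω / ε - ρ / (2 * ε))) = C₁ at *
  generalize Real.cosh (π * (-ω / ε + ρ / (2 * ε))) = C₂ at *
  field_simp
  linear_combination hq

theorem one_minus_norm_sRef_sq {α δ μ ε z : ℝ} (hμ : 0 < μ) (hε : 0 < ε) (hz : z ≤ 0) :
    1 - ‖sRef α δ μ ε (z : ℂ)‖ ^ 2 =
      (Real.cosh (π * (4 / α * (z - (1 - α * δ) / 4)) / ε) + Real.cosh (π * μ / ε)) /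
        (Real.cosh (π * (4 / α * (z - (1 - α * δ) / 4)) / ε) +
          Real.cosh (π * Real.sqrt (μ ^ 2 - 16 * z) / ε)) := by
  rw [norm_sRef_sq hμ hε hz, eq_div_iff (add_pos (Real.cosh_pos _) (Real.cosh_pos _)).ne', sub_mul,
    div_mul_cancel₀ _ (add_pos (Real.cosh_pos _) (Real.cosh_pos _)).ne']
  ring

theorem two_mul_cosh_add_cosh_mul_exp_neg_mem_Icc {x y d : ℝ} (hd : 0 ≤ d) (h : |x| + d ≤ y) :
    2 * (Real.cosh x + Real.cosh y) * Real.exp (-y) ∈ Icc 1 (1 + 3 * Real.exp (-d)) := by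
  have e : 2 * (Real.cosh x + Real.cosh y) * Real.exp (-y) =
      1 + Real.exp (x - y) + Real.exp (-x - y) + Real.exp (-y - y) := by
    rw [Real.cosh_eq, Real.cosh_eq, sub_eq_add_neg, sub_eq_add_neg, sub_eq_add_neg, Real.exp_add,
      Real.exp_add, Real.exp_add]
    have : Real.exp y * Real.exp (-y) = 1 := by rw [← Real.exp_add]; simp
    linear_combination this
  have hx := abs_le.1 (le_refl |x|)
  have h0 := abs_nonneg x
  have h1 : Real.exp (x - y) ≤ Real.exp (-d) := Real.exp_le_exp.2 (by linarith)
  have h2 : Real.exp (-x - y) ≤ Real.exp (-d) := Real.exp_le_exp.2 (by linarith)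
  have h3 : Real.exp (-y - y) ≤ Real.exp (-d) := Real.exp_le_exp.2 (by linarith)
  rw [e]
  constructor <;> linarith [Real.exp_pos (x - y), Real.exp_pos (-x - y), Real.exp_pos (-y - y)]

theorem abs_cosh_ratio_mul_exp_sub_one_le {x y w u d : ℝ} (hd : 0 ≤ d) (h₁ : |x| + d ≤ y)
    (h₂ : |w| + d ≤ u) :
    |(Real.cosh x + Real.cosh y) / (Real.cosh w + Real.cosh u) * Real.exp (u - y) - 1| ≤
      3 * Real.exp (-d) := by
  have hn := two_mul_cosh_add_cosh_mul_exp_neg_mem_Icc hd h₁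
  have hm := two_mul_cosh_add_cosh_mul_exp_neg_mem_Icc hd h₂
  have e : (Real.cosh x + Real.cosh y) / (Real.cosh w + Real.cosh u) * Real.exp (u - y) =
      (2 * (Real.cosh x + Real.cosh y) * Real.exp (-y)) /
        (2 * (Real.cosh w + Real.cosh u) * Real.exp (-u)) := by
    have hp := (add_pos (Real.cosh_pos w) (Real.cosh_pos u)).ne'
    rw [sub_eq_add_neg, Real.exp_add, Real.exp_neg u]
    field_simp
  rw [e]
  set n := 2 * (Real.cosh x + Real.cosh y) * Real.exp (-y)
  set m := 2 * (Real.cosh w + Real.cosh u) * Real.exp (-u)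
  have hm0 : 0 < m := by linarith [hm.1]
  rw [div_sub_one hm0.ne', abs_div, abs_of_pos hm0, div_le_iff₀ hm0]
  have : |n - m| ≤ 3 * Real.exp (-d) := abs_le.2 ⟨by linarith [hn.1, hm.2], by linarith [hn.2, hm.1]⟩
  exact this.trans (le_mul_of_one_le_right (by positivity) hm.1)

theorem exists_gap_left {α δ μ η : ℝ} (hα : 0 < α) (hT2 : μ ^ 2 > 4 * (1 - α * δ)) (hμ : 0 < μ)
    (hη : 0 < η) :
    ∃ c : ℝ, 0 < c ∧ ∀ z ∈ Icc (zminus α δ μ + η) (zInf α δ μ - η),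
      μ + c ≤ -(4 / α * (z - (1 - α * δ) / 4)) ∧
      -(4 / α * (z - (1 - α * δ) / 4)) + c ≤ Real.sqrt (μ ^ 2 - 16 * z) := by
  set a := (1 - α * δ) / 4 with ha
  set W := |4 / α * (zminus α δ μ - a)| with hW
  have hW0 : 0 ≤ W := abs_nonneg _
  set q := 16 * η ^ 2 / α ^ 2 with hq
  have hq0 : 0 < q := by positivity
  refine ⟨min (4 / α * η) (min 1 (q / (2 * W + 1))), by positivity, ?_⟩
  rintro z ⟨hz1, hz2⟩
  set c := min (4 / α * η) (min 1 (q / (2 * W + 1))) with hc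
  have hc0 : 0 < c := by positivity
  have hc1 : c ≤ 4 / α * η := min_le_left _ _
  have hc2 : c ≤ 1 := (min_le_right _ _).trans (min_le_left _ _)
  have hc3 : c * (2 * W + 1) ≤ q := by
    rw [← le_div_iff₀ (by positivity)]
    exact (min_le_right _ _).trans (min_le_right _ _)
  have hα4 : 0 < 4 / α := by positivity
  have hzI : 4 / α * (zInf α δ μ - a) = -μ := by
    rw [zInf, ha]; field_simp; ring
  have hmono : 4 / α * z ≤ 4 / α * (zInf α δ μ - η) := mul_le_mul_of_nonneg_left hz2 hα4.le
  have hmono' : 4 / α * zminus α δ μ ≤ 4 / α * z :=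
    mul_le_mul_of_nonneg_left (by linarith) hα4.le
  set x := -(4 / α * (z - a)) with hx
  have hx1 : μ + 4 / α * η ≤ x := by rw [hx]; linarith
  have hx2 : x ≤ W := by
    refine le_trans ?_ (neg_le_abs _)
    rw [hx]; linarith
  refine ⟨by linarith, Real.le_sqrt_of_sq_le ?_⟩
  have hD : 0 ≤ discrm α δ μ := by
    rw [discrm]; nlinarith [sq_nonneg (α ^ 2), mul_pos (pow_pos hα 2) (sub_pos.2 hT2)]
  have hpoly : μ ^ 2 - 16 * z - x ^ 2 =
      16 / α ^ 2 * ((z - zminus α δ μ) * (zplus α δ μ - z)) := by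
    have hs := Real.sq_sqrt hD
    rw [zminus, zplus, hx, ha]
    generalize Real.sqrt (discrm α δ μ) = s at *
    rw [discrm] at hs
    field_simp
    linear_combination -64 * hs
  have hplus : a ≤ zplus α δ μ := by
    have : α ^ 2 ≤ Real.sqrt (discrm α δ μ) := by
      apply Real.le_sqrt_of_sq_le
      rw [discrm]; nlinarith [mul_pos (pow_pos hα 2) (sub_pos.2 hT2)]
    rw [zplus, ha]; linarith
  have hzIa : zInf α δ μ ≤ a := by
    rw [zInf, ha]; nlinarith [mul_pos hα hμ]
  have hprod : η ^ 2 ≤ (z - zminus α δ μ) * (zplus α δ μ - z) := by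
    rw [sq]; exact mul_le_mul (by linarith) (by linarith) hη.le (by linarith)
  have : q ≤ μ ^ 2 - 16 * z - x ^ 2 := by
    rw [hpoly, hq, mul_div_right_comm]
    exact mul_le_mul_of_nonneg_left hprod (by positivity)
  nlinarith

theorem exists_gap_right {α δ μ η : ℝ} (hα : 0 < α) (hT1 : α * |μ| > |1 - α * δ|) (hμ : 0 < μ)
    (hη : 0 < η) :
    ∃ c : ℝ, 0 < c ∧ ∀ z ∈ Icc (zInf α δ μ + η) 0,
      |4 / α * (z - (1 - α * δ) / 4)| + c ≤ μ ∧ μ ≤ Real.sqrt (μ ^ 2 - 16 * z) := by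
  have hα4 : 0 < 4 / α := by positivity
  rw [abs_of_pos hμ] at hT1
  have hb : 0 < μ - |1 - α * δ| / α := by
    rw [sub_pos, div_lt_iff₀ hα]; linarith
  refine ⟨min (4 / α * η) (μ - |1 - α * δ| / α), by positivity, ?_⟩
  rintro z ⟨hz1, hz2⟩
  refine ⟨?_, Real.le_sqrt_of_sq_le (by linarith)⟩
  have hc1 := min_le_left (4 / α * η) (μ - |1 - α * δ| / α)
  have hc2 := min_le_right (4 / α * η) (μ - |1 - α * δ| / α)
  rw [← le_sub_iff_add_le, abs_le]
  have hzI : 4 / α * (zInf α δ μ - (1 - α * δ) / 4) = -μ := by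
    rw [zInf]; field_simp; ring
  have hmono := mul_le_mul_of_nonneg_left hz1 hα4.le
  have hmono' := mul_le_mul_of_nonneg_left hz2 hα4.le
  have h0 : -(4 / α * ((1 - α * δ) / 4)) ≤ |1 - α * δ| / α := by
    rw [show -(4 / α * ((1 - α * δ) / 4)) = -(1 - α * δ) / α by field_simp]
    exact div_le_div_of_nonneg_right (neg_le_abs _) hα.le
  constructor <;> linarith

/-- `1 − |s(z)|² = e^{−τ(z)/ε}(1 + exponentially small)` uniformly on
`[z_L+η, z_∞−η] ∪ [z_∞+η, 0]`. -/
theorem one_minus_modulus_squared_asymptotics (α δ μ : ℝ) (hα : 0 < α)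
    (hT1 : α * |μ| > |1 - α*δ|) (hT2 : μ^2 > 4*(1 - α*δ)) (hT3 : 0 < μ) :
    ∀ η : ℝ, 0 < η → ∃ c : ℝ, 0 < c ∧ ∃ C : ℝ, 0 < C ∧ ∃ ε₀ : ℝ, 0 < ε₀ ∧
      ∀ ε : ℝ, ε ∈ Set.Ioc 0 ε₀ →
        ∀ z : ℝ, z ∈ Set.Icc (zminus α δ μ + η) (zInf α δ μ - η) ∪ Set.Icc (zInf α δ μ + η) 0 →
          |(1 - ‖sRef α δ μ ε (z:ℂ)‖^2) * Real.exp (tauF α δ μ z / ε) - 1|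
            ≤ C * Real.exp (-c / ε) := by
  intro η hη
  obtain ⟨c₁, hc₁, h₁⟩ := exists_gap_left hα hT2 hT3 hη
  obtain ⟨c₂, hc₂, h₂⟩ := exists_gap_right hα hT1 hT3 hη
  have hzI : zInf α δ μ < 0 := by
    rw [abs_of_pos hT3] at hT1
    rw [zInf]; linarith [le_abs_self (1 - α * δ)]
  refine ⟨π * min c₁ c₂, by positivity, 3, by norm_num, 1, one_pos, ?_⟩
  rintro ε ⟨hε, -⟩ z hz
  have scale : ∀ {p q : ℝ}, p + min c₁ c₂ ≤ q → π * p / ε + π * min c₁ c₂ / ε ≤ π * q / ε := by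
    intro p q h
    rw [← add_div, ← mul_add]
    gcongr
  have habs : ∀ p : ℝ, |π * p / ε| = π * |p| / ε := fun p => by
    rw [abs_div, abs_mul, abs_of_pos hε, abs_of_pos Real.pi_pos]
  have hd : 0 ≤ π * min c₁ c₂ / ε := by positivity
  have hz0 : z ≤ 0 := by
    rcases hz with hz | hz
    · linarith [hz.2]
    · exact hz.2
  rw [one_minus_norm_sRef_sq hT3 hε hz0, neg_div]
  rcases hz with hz | hz
  · obtain ⟨g1, g2⟩ := h₁ z hz
    have hm := min_le_left c₁ c₂
    rw [tauF, if_pos (by linarith [hz.2])]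
    set t := 4 / α * (z - (1 - α * δ) / 4) with ht
    have key := abs_cosh_ratio_mul_exp_sub_one_le (x := π * μ / ε) (y := π * (-t) / ε)
      (w := π * t / ε) (u := π * Real.sqrt (μ ^ 2 - 16 * z) / ε) hd
      (by rw [habs, abs_of_pos hT3]; exact scale (by linarith))
      (by rw [habs, abs_of_neg (by linarith)]; exact scale (by linarith))
    convert key using 5
    · rw [add_comm, mul_neg, neg_div, Real.cosh_neg]
    · rw [ht]; ring
  · obtain ⟨g1, g2⟩ := h₂ z hz
    have hm := min_le_right c₁ c₂
    rw [tauF, if_neg (by linarith [hz.1])]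
    have key := abs_cosh_ratio_mul_exp_sub_one_le (y := π * μ / ε)
      (x := π * (4 / α * (z - (1 - α * δ) / 4)) / ε)
      (w := π * (4 / α * (z - (1 - α * δ) / 4)) / ε)
      (u := π * Real.sqrt (μ ^ 2 - 16 * z) / ε) hd
      (by rw [habs]; exact scale (by linarith))
      (by rw [habs]; exact scale (by linarith))
    rwa [← sub_div] at key
end
end

section
/- Assume (T1) α|μ| > |1−αδ|, (T2) μ² > 4(1−αδ), (T3) μ > 0, and let ρ₀(x) := sech²x, u₀(x) := δ + μ·tanh(x), χ(x;z) := (4z−1+αu₀(x))² + 16α²z·ρ₀(x), and x_c := arctanh(T_c). Then for each real x < x_c: (i) the quadratic z ↦ χ(x;z) has no real roots, and its two roots are a complex-conjugate pair 𝔷(x), conj(𝔷(x)) with Im 𝔷(x) > 0; (ii) Re 𝔷(x) = −(αu₀(x) − 1 + 2α²ρ₀(x))/4 and |𝔷(x)|² = (αu₀(x)−1)²/16; (iii) the function x ↦ Re 𝔷(x) is strictly decreasing on (−∞, x_c); (iv) Re 𝔷(x) < z_P for every x < x_c, and 𝔷(x) → z_P as x → −∞, so sup_{x<x_c} Re 𝔷(x)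 = z_P. -/
open Complex Real Filter Set MeasureTheory ComplexConjugate Topology

noncomputable section

/-- `A = (1−αδ)/(4α²)`. -/
def Acoef (α δ : ℝ) : ℝ := (1 - α*δ)/(4*α^2)

/-- `B = μ/(4α)`. -/
def Bcoef (α μ : ℝ) : ℝ := μ/(4*α)

/-- `T_c = 2B − √(4B²−4A+1)`. -/
def Tcrit (α δ μ : ℝ) : ℝ :=
  2*Bcoef α μ - Real.sqrt (4*(Bcoef α μ)^2 - 4*Acoef α δ + 1)

/-- The initial Madelung density `ρ₀ = sech² x`. -/
def rho0 (x : ℝ) : ℝ := (sech x)^2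

/-- The initial Madelung velocity `u₀ = δ + μ tanh x`. -/
def u0 (δ μ : ℝ) (x : ℝ) : ℝ := δ + μ*Real.tanh x

/-- The WKB characteristic quadratic `χ(x;z) = (4z−1+αu₀(x))² + 16α²z·ρ₀(x)` (in `z ∈ ℂ`). -/
def chiC (α δ μ : ℝ) (x : ℝ) (z : ℂ) : ℂ :=
  (4*z - 1 + ((α * u0 δ μ x : ℝ) : ℂ))^2 + ((16*α^2*rho0 x : ℝ) : ℂ) * z

theorem rho0_eq_one_sub_tanh_sq (x : ℝ) : rho0 x = 1 - Real.tanh x ^ 2 := by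
  have hc : Real.cosh x ≠ 0 := (Real.cosh_pos x).ne'
  rw [rho0, sech, Real.tanh_eq_sinh_div_cosh]
  field_simp
  linarith [Real.cosh_sq x]

theorem tanh_lt_of_lt_arctanh {x T : ℝ} (hT : T ∈ Ioo (-1) 1) (hx : x < arctanh T) :
    Real.tanh x < T := by
  have h : arctanh T = Real.artanh T := by
    rw [arctanh, Real.artanh_eq_half_log ⟨hT.1.le, hT.2.le⟩]
    ring
  rw [h, ← Real.artanh_tanh x] at hx
  exact (Real.artanh_lt_artanh_iff ⟨Real.neg_one_lt_tanh x, Real.tanh_lt_one x⟩ hT).1 hx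

theorem tanh_strictMono : StrictMono Real.tanh := fun x y hxy => by
  rw [← Real.artanh_tanh x, ← Real.artanh_tanh y] at hxy
  exact (Real.artanh_lt_artanh_iff ⟨Real.neg_one_lt_tanh x, Real.tanh_lt_one x⟩
    ⟨Real.neg_one_lt_tanh y, Real.tanh_lt_one y⟩).1 hxy

theorem tendsto_tanh_atBot : Tendsto Real.tanh atBot (𝓝 (-1)) := by
  have h : Real.tanh = fun x => (Real.exp x ^ 2 - 1) / (Real.exp x ^ 2 + 1) := by
    funext x
    have := Real.exp_pos x
    rw [Real.tanh_eq, Real.exp_neg]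
    field_simp
  have he : Tendsto (fun x => Real.exp x ^ 2) atBot (𝓝 0) := by
    simpa using Real.tendsto_exp_atBot.pow 2
  rw [h]
  simpa using! (he.sub_const 1).div (he.add_const 1) (by norm_num)

theorem Acoef_lt_Bcoef {α δ μ : ℝ} (hα : 0 < α) (h : |1 - α * δ| < α * |μ|) (hμ : 0 < μ) :
    Acoef α δ < Bcoef α μ := by
  rw [abs_of_pos hμ] at h
  rw [Acoef, Bcoef, div_lt_div_iff₀ (by positivity) (by positivity)]
  nlinarith [mul_pos hα (sub_pos.2 ((le_abs_self _).trans_lt h))]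

theorem neg_Bcoef_lt_Acoef {α δ μ : ℝ} (hα : 0 < α) (h : |1 - α * δ| < α * |μ|) (hμ : 0 < μ) :
    -Bcoef α μ < Acoef α δ := by
  rw [abs_of_pos hμ] at h
  rw [Acoef, Bcoef, ← neg_div, div_lt_div_iff₀ (by positivity) (by positivity)]
  nlinarith [mul_pos hα (sub_pos.2 ((neg_abs_le _).trans_lt' (neg_lt_neg h)))]

theorem Acoef_lt_Bcoef_sq {α δ μ : ℝ} (hα : 0 < α) (h : 4 * (1 - α * δ) < μ ^ 2) :
    Acoef α δ < Bcoef α μ ^ 2 := by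
  rw [Acoef, Bcoef, div_pow, div_lt_div_iff₀ (by positivity) (by positivity)]
  nlinarith [mul_pos (pow_pos hα 2) (sub_pos.2 h)]

theorem quadratic_pos_of_lt_smaller_root {A B t : ℝ} (h : 0 ≤ 4 * B ^ 2 - 4 * A + 1)
    (ht : t < 2 * B - √(4 * B ^ 2 - 4 * A + 1)) : 0 < t ^ 2 - 4 * B * t + 4 * A - 1 := by
  nlinarith [Real.sq_sqrt h, Real.sqrt_nonneg (4 * B ^ 2 - 4 * A + 1)]

theorem smaller_root_mem_Ioo {A B : ℝ} (h₁ : A < B) (h₂ : -B < A) :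
    2 * B - √(4 * B ^ 2 - 4 * A + 1) ∈ Ioo (-1) 1 := by
  constructor
  · have : √(4 * B ^ 2 - 4 * A + 1) < 2 * B + 1 := by
      rw [Real.sqrt_lt' (by linarith)]
      nlinarith
    linarith
  · have : 2 * B - 1 < √(4 * B ^ 2 - 4 * A + 1) := by
      apply Real.lt_sqrt_of_sq_lt
      nlinarith
    linarith

theorem smaller_root_le {A B : ℝ} (h₁ : A < B) (h₂ : A < B ^ 2) :
    2 * B - √(4 * B ^ 2 - 4 * A + 1) ≤ B := by
  have : B ≤ √(4 * B ^ 2 - 4 * A + 1) := by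
    apply Real.le_sqrt_of_sq_le
    rcases le_total B 1 with hB | hB <;> nlinarith
  linarith

/-- The root in the closed upper half-plane of `(4z + w)² + 16az`, when its roots are not real. -/
def upperRoot (w a : ℝ) : ℂ := ⟨-(w + 2 * a) / 4, √(-(a * (w + a))) / 2⟩

theorem continuous_upperRoot : Continuous fun p : ℝ × ℝ => upperRoot p.1 p.2 := by
  have h : (fun p : ℝ × ℝ => upperRoot p.1 p.2) = fun p =>
      ((-(p.1 + 2 * p.2) / 4 : ℝ) : ℂ) + ((√(-(p.2 * (p.1 + p.2))) / 2 : ℝ) : ℂ) * Complex.I := by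
    funext p
    exact Complex.mk_eq_add_mul_I _ _
  rw [h]
  fun_prop

theorem upperRoot_im_sq {w a : ℝ} (h : 0 ≤ -(a * (w + a))) :
    (upperRoot w a).im ^ 2 = -(a * (w + a)) / 4 := by
  rw [upperRoot, div_pow, Real.sq_sqrt h]
  norm_num

theorem upperRoot_im_pos {w a : ℝ} (h : 0 < -(a * (w + a))) : 0 < (upperRoot w a).im :=
  div_pos (Real.sqrt_pos.2 h) two_pos

theorem norm_upperRoot_sq {w a : ℝ} (h : 0 ≤ -(a * (w + a))) :
    ‖upperRoot w a‖ ^ 2 = w ^ 2 / 16 := by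
  have him := upperRoot_im_sq h
  have hre : (upperRoot w a).re = -(w + 2 * a) / 4 := rfl
  rw [Complex.sq_norm, Complex.normSq_apply, hre]
  linear_combination him

theorem quadratic_eq_upperRoot_mul_conj {w a : ℝ} (h : 0 ≤ -(a * (w + a))) (z : ℂ) :
    (4 * z + w) ^ 2 + 16 * a * z =
      16 * (z - upperRoot w a) * (z - (starRingEnd ℂ) (upperRoot w a)) := by
  have hadd := Complex.add_conj (upperRoot w a)
  have hmul := Complex.mul_conj' (upperRoot w a)
  rw [← Complex.ofReal_pow, norm_upperRoot_sq h] at hmul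
  have hre : (upperRoot w a).re = -(w + 2 * a) / 4 := rfl
  rw [hre] at hadd
  push_cast at hadd hmul
  linear_combination 16 * z * hadd - 16 * hmul

/-- the complex branch `𝔷(x)` of the turning point curve for `x < x_c`. -/
theorem complex_turning_point_branch (α δ μ : ℝ) (hα : 0 < α)
    (hT1 : α * |μ| > |1 - α*δ|) (hT2 : μ^2 > 4*(1 - α*δ)) (hT3 : 0 < μ) :
    ∃ zfr : ℝ → ℂ,
      (∀ x : ℝ, x < arctanh (Tcrit α δ μ) →
        -- (i) no real roots; the roots form a conjugate pair 𝔷(x), conj 𝔷(x), Im 𝔷(x) > 0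
        (∀ zr : ℝ, chiC α δ μ x (zr:ℂ) ≠ 0) ∧
        0 < (zfr x).im ∧
        (∀ z : ℂ, chiC α δ μ x z = 16 * (z - zfr x) * (z - (starRingEnd ℂ) (zfr x))) ∧
        -- (ii) explicit real part and modulus
        (zfr x).re = -(α * u0 δ μ x - 1 + 2*α^2*rho0 x)/4 ∧
        ‖zfr x‖^2 = (α * u0 δ μ x - 1)^2/16 ∧
        -- (iv) bound by z_P
        (zfr x).re < zP α δ μ) ∧
      -- (iii) strict monotonicity of the real part
      StrictAntiOn (fun x => (zfr x).re) (Set.Iio (arctanh (Tcrit α δ μ))) ∧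
      -- (iv) limit and supremum
      Filter.Tendsto zfr Filter.atBot (𝓝 ((zP α δ μ : ℝ) : ℂ)) ∧
      IsLUB ((fun x => (zfr x).re) '' Set.Iio (arctanh (Tcrit α δ μ))) (zP α δ μ) := by
  have hAB := Acoef_lt_Bcoef hα hT1 hT3
  have hBA := neg_Bcoef_lt_Acoef hα hT1 hT3
  have hABsq := Acoef_lt_Bcoef_sq hα hT2
  have hTmem : Tcrit α δ μ ∈ Ioo (-1) 1 := smaller_root_mem_Ioo hAB hBA
  have hTle : Tcrit α δ μ ≤ Bcoef α μ := smaller_root_le hAB hABsq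
  have hA : 4 * α ^ 2 * Acoef α δ = 1 - α * δ := by
    rw [Acoef]
    field_simp
  have hB : 4 * α * Bcoef α μ = μ := by
    rw [Bcoef]
    field_simp
  have htanh {x : ℝ} (hx : x < arctanh (Tcrit α δ μ)) : Real.tanh x < Tcrit α δ μ :=
    tanh_lt_of_lt_arctanh hTmem hx
  have hanti {s t : ℝ} (hst : s < t) (ht : t < Tcrit α δ μ) :
      -(α * (δ + μ * t) - 1 + 2 * (α ^ 2 * (1 - t ^ 2))) / 4 <
        -(α * (δ + μ * s) - 1 + 2 * (α ^ 2 * (1 - s ^ 2))) / 4 := by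
    have h : 0 < α ^ 2 * ((t - s) * (4 * Bcoef α μ - 2 * (s + t))) :=
      mul_pos (pow_pos hα 2) (mul_pos (by linarith) (by linarith))
    linear_combination h / 4 + α * (t - s) / 4 * hB
  have hneg {x : ℝ} (hx : x < arctanh (Tcrit α δ μ)) :
      0 < -(α ^ 2 * rho0 x * (α * u0 δ μ x - 1 + α ^ 2 * rho0 x)) := by
    have hq : 0 < Real.tanh x ^ 2 - 4 * Bcoef α μ * Real.tanh x + 4 * Acoef α δ - 1 :=
      quadratic_pos_of_lt_smaller_root (by linarith) (htanh hx)
    have hρ : 0 < rho0 x := by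
      rw [rho0_eq_one_sub_tanh_sq]
      linarith [Real.tanh_sq_lt_one x]
    have hw : α * u0 δ μ x - 1 + α ^ 2 * rho0 x < 0 := by
      rw [rho0_eq_one_sub_tanh_sq, u0]
      linear_combination α ^ 2 * hq + hA - α * Real.tanh x * hB
    exact neg_pos.2 (mul_neg_of_pos_of_neg (by positivity) hw)
  set zfr : ℝ → ℂ := fun x => upperRoot (α * u0 δ μ x - 1) (α ^ 2 * rho0 x) with hzfr
  have hre (x : ℝ) : (zfr x).re =
      -(α * (δ + μ * Real.tanh x) - 1 + 2 * (α ^ 2 * (1 - Real.tanh x ^ 2))) / 4 := by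
    rw [← rho0_eq_one_sub_tanh_sq]
    rfl
  have hfactor {x : ℝ} (hx : x < arctanh (Tcrit α δ μ)) (z : ℂ) :
      chiC α δ μ x z = 16 * (z - zfr x) * (z - (starRingEnd ℂ) (zfr x)) := by
    rw [hzfr, ← quadratic_eq_upperRoot_mul_conj (hneg hx).le z, chiC]
    push_cast
    ring
  have hlt {x : ℝ} (hx : x < arctanh (Tcrit α δ μ)) : (zfr x).re < zP α δ μ := by
    rw [hre, zP]
    linarith [hanti (Real.neg_one_lt_tanh x) (htanh hx)]
  have hlim : Tendsto zfr atBot (𝓝 ((zP α δ μ : ℝ) : ℂ)) := by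
    have hc : Continuous fun t : ℝ =>
        upperRoot (α * (δ + μ * t) - 1) (α ^ 2 * (1 - t ^ 2)) :=
      continuous_upperRoot.comp
        (f := fun t : ℝ => (α * (δ + μ * t) - 1, α ^ 2 * (1 - t ^ 2))) (by fun_prop)
    have h := (hc.tendsto (-1)).comp tendsto_tanh_atBot
    have hz : upperRoot (α * (δ + μ * (-1)) - 1) (α ^ 2 * (1 - (-1) ^ 2)) =
        ((zP α δ μ : ℝ) : ℂ) := by
      apply Complex.ext
      · simp only [upperRoot, zP, Complex.ofReal_re]
        ring
      · simp [upperRoot]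
    rw [hz] at h
    refine h.congr fun x => ?_
    rw [Function.comp_apply, ← rho0_eq_one_sub_tanh_sq]
    rfl
  refine ⟨zfr, fun x hx => ⟨fun r hr => ?_, upperRoot_im_pos (hneg hx), hfactor hx, ?_,
    norm_upperRoot_sq (hneg hx).le, hlt hx⟩, fun x _ y hy hxy => ?_, hlim, ?_, fun b hb => ?_⟩
  · have him := upperRoot_im_pos (hneg hx)
    rw [hfactor hx, mul_eq_zero, mul_eq_zero, sub_eq_zero, sub_eq_zero] at hr
    rcases hr with (hr | hr) | hr
    · norm_num at hr
    · exact him.ne' (by simpa using (congrArg Complex.im hr).symm)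
    · exact him.ne' (by simpa using (congrArg Complex.im hr).symm)
  · rw [hzfr, mul_assoc 2]
    rfl
  · simp only [hre]
    exact hanti (tanh_strictMono hxy) (htanh hy)
  · rintro _ ⟨x, hx, rfl⟩
    exact (hlt hx).le
  · refine le_of_tendsto ((Complex.continuous_re.tendsto _).comp hlim) ?_
    filter_upwards [Iio_mem_atBot (arctanh (Tcrit α δ μ))] with x hx
    exact hb ⟨x, hx, rfl⟩
end
end
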